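/- Let N = 2, let q ∈ ℂ* be not a root of unity (or q = 1), and let ξ = diag(ξ₁, ξ₂). If ξ₁ − q^{2k} ξ₂ ≠ 0 for all k = 0, 1, 2, …, then the image of the co-orbit map β^ξ is exactly O(D\GL_q). -/

import Mathlib

open TensorProduct

noncomputable section

/-- Number of inversions (the length) of a permutation of `Fin t`. -/
def invCount {t : ℕ} (σ : Equiv.Perm (Fin t)) : ℕ :=
  (Finset.univ.filter fun p : Fin t × Fin t => p.1 < p.2 ∧ σ p.2 < σ p.1).card

/-- The principal quantum minor `[I|I]` of the matrix of generators `x`. -/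
def qMinor {A : Type} [CommRing A] {M : Type} [Ring M] [Algebra A M] {N : ℕ}
    (q : A) (x : Fin N → Fin N → M) (I : Finset (Fin N)) : M :=
  ∑ σ : Equiv.Perm (Fin I.card),
    ((-q) ^ invCount σ) •
      ((List.finRange I.card).map fun k =>
        x ((I.orderIsoOfFin rfl) k).1 ((I.orderIsoOfFin rfl) (σ k)).1).prod

/-- The quantum determinant. -/
def qdet {A : Type} [CommRing A] {M : Type} [Ring M] [Algebra A M] {N : ℕ}
    (q : A) (x : Fin N → Fin N → M) : M :=
  qMinor q x Finset.univ

/-- `w(I)`: the sum of the elements of `I` (with `{1, …, N}` indexing). -/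
def wtSet {N : ℕ} (I : Finset (Fin N)) : ℕ := ∑ j ∈ I, (j.1 + 1)

/-- The weighted sum `τ_i` of principal quantum minors of size `i`. -/
def tauCoinv {A : Type} [CommRing A] {M : Type} [Ring M] [Algebra A M] {N : ℕ}
    (q qinv : A) (x : Fin N → Fin N → M) (i : ℕ) : M :=
  ∑ I ∈ Finset.univ.filter (fun I : Finset (Fin N) => I.card = i),
    qinv ^ (2 * wtSet I) • qMinor q x I

/-- The sum `σ_i` of all principal quantum minors of size `i`. -/
def sigmaCoinv {A : Type} [CommRing A] {M : Type} [Ring M] [Algebra A M] {N : ℕ}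
    (q : A) (x : Fin N → Fin N → M) (i : ℕ) : M :=
  ∑ I ∈ Finset.univ.filter (fun I : Finset (Fin N) => I.card = i), qMinor q x I

/-- The right adjoint coaction `β(h) = Σ h₂ ⊗ S(h₁)h₃`. -/
def adjBeta {A : Type} [CommRing A] {M G : Type} [Ring M] [Algebra A M] [Ring G] [Algebra A G]
    (ΔM : M →ₐ[A] M ⊗[A] M) (ι : M →ₐ[A] G) (St : G →ₗ[A] G) : M →ₗ[A] M ⊗[A] G :=
  TensorProduct.map LinearMap.id (LinearMap.mul' A G) ∘ₗ
  (TensorProduct.assoc A M G G).toLinearMap ∘ₗ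
  TensorProduct.map
    ((TensorProduct.comm A G M).toLinearMap ∘ₗ
      TensorProduct.map (St ∘ₗ ι.toLinearMap) LinearMap.id)
    ι.toLinearMap ∘ₗ
  TensorProduct.map ΔM.toLinearMap LinearMap.id ∘ₗ ΔM.toLinearMap

/-- The right coaction `α(h) = Σ h₂ ⊗ h₃S(h₁)`. -/
def adjAlpha {A : Type} [CommRing A] {M G : Type} [Ring M] [Algebra A M] [Ring G] [Algebra A G]
    (ΔM : M →ₐ[A] M ⊗[A] M) (ι : M →ₐ[A] G) (St : G →ₗ[A] G) : M →ₗ[A] M ⊗[A] G :=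
  TensorProduct.map LinearMap.id (LinearMap.mul' A G) ∘ₗ
  TensorProduct.map LinearMap.id (TensorProduct.comm A G G).toLinearMap ∘ₗ
  (TensorProduct.assoc A M G G).toLinearMap ∘ₗ
  TensorProduct.map
    ((TensorProduct.comm A G M).toLinearMap ∘ₗ
      TensorProduct.map (St ∘ₗ ι.toLinearMap) LinearMap.id)
    ι.toLinearMap ∘ₗ
  TensorProduct.map ΔM.toLinearMap LinearMap.id ∘ₗ ΔM.toLinearMap

/-- The co-orbit map associated to a point `e = ev_ξ` and a coaction `b`. -/
def coorbit {A : Type} [CommRing A] {M G : Type} [Ring M] [Algebra A M] [Ring G] [Algebra A G]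
    (e : M →ₐ[A] A) (b : M →ₗ[A] M ⊗[A] G) : M →ₗ[A] G :=
  (TensorProduct.lid A G).toLinearMap ∘ₗ TensorProduct.map e.toLinearMap LinearMap.id ∘ₗ b

/-- The left coaction `λ_D = (π_D ⊗ id) ∘ Δ` of a quotient Hopf algebra. -/
def leftCoact {A : Type} [CommRing A] {G D : Type} [Ring G] [Algebra A G]
    [CommRing D] [Algebra A D]
    (πD : G →ₐ[A] D) (ΔG : G →ₐ[A] G ⊗[A] G) : G →ₗ[A] D ⊗[A] G :=
  TensorProduct.map πD.toLinearMap LinearMap.id ∘ₗ ΔG.toLinearMap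

/-- Coinvariants of the left coaction `λ_D`. -/
def dCoinv {A : Type} [CommRing A] {G D : Type} [Ring G] [Algebra A G]
    [CommRing D] [Algebra A D]
    (πD : G →ₐ[A] D) (ΔG : G →ₐ[A] G ⊗[A] G) : Set G :=
  {f : G | leftCoact πD ΔG f = (1 : D) ⊗ₜ[A] f}

/-- The right coaction `ρ_D = (id ⊗ π_D) ∘ Δ`. -/
def rightCoact {A : Type} [CommRing A] {G D : Type} [Ring G] [Algebra A G]
    [CommRing D] [Algebra A D]
    (πD : G →ₐ[A] D) (ΔG : G →ₐ[A] G ⊗[A] G) : G →ₗ[A] G ⊗[A] D :=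
  TensorProduct.map LinearMap.id πD.toLinearMap ∘ₗ ΔG.toLinearMap

/-- The weight space of weight `ta : D` for the grading induced by `ρ_D`. -/
def weightSpace' {A : Type} [CommRing A] {G D : Type} [Ring G] [Algebra A G]
    [CommRing D] [Algebra A D]
    (πD : G →ₐ[A] D) (ΔG : G →ₐ[A] G ⊗[A] G) (ta : D) : Submodule A G :=
  LinearMap.ker (rightCoact πD ΔG - (TensorProduct.mk A G D).flip ta)

/-- The subcomodule generated by a subset `s` of the comodule `(M, b)`. -/
def comodGen {A : Type} [CommRing A] {M G : Type} [Ring M] [Algebra A M] [Ring G] [Algebra A G]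
    (b : M →ₗ[A] M ⊗[A] G) (s : Set M) : Submodule A M :=
  sInf {W : Submodule A M | s ⊆ W ∧
    ∀ w ∈ W, b w ∈ LinearMap.range (TensorProduct.map W.subtype (LinearMap.id : G →ₗ[A] G))}

/-- `x` and `y` commute up to the scalar `r`. -/
def QCommute {K G : Type*} [Field K] [Ring G] [Algebra K G] (r : K) (x y : G) : Prop :=
  x * y = r • (y * x)

namespace QCommute

variable {K G : Type*} [Field K] [Ring G] [Algebra K G] {r s : K} {x y z : G}

theorem inv_symm (hr : r ≠ 0) (h : QCommute r x y) : QCommute r⁻¹ y x := by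
  unfold QCommute at *
  rw [h, smul_smul, inv_mul_cancel₀ hr, one_smul]

theorem of_commute (h : Commute x y) : QCommute (1 : K) x y := by
  rw [QCommute, one_smul, h.eq]

theorem mul_right (h₁ : QCommute r x y) (h₂ : QCommute s x z) : QCommute (r * s) x (y * z) := by
  unfold QCommute at *
  rw [← mul_assoc, h₁, smul_mul_assoc, mul_assoc, h₂, mul_smul_comm, smul_smul, mul_assoc]

theorem mul_left (h₁ : QCommute r x z) (h₂ : QCommute s y z) : QCommute (r * s) (x * y) z := by
  unfold QCommute at *
  rw [mul_assoc, h₂, mul_smul_comm, ← mul_assoc, h₁, smul_mul_assoc, smul_smul, mul_assoc,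
    mul_comm r]

theorem pow_right (h : QCommute r x y) (n : ℕ) : QCommute (r ^ n) x (y ^ n) := by
  induction n with
  | zero => simp [QCommute]
  | succ n ih => rw [pow_succ, pow_succ]; exact ih.mul_right h

theorem pow_left (h : QCommute r x y) (n : ℕ) : QCommute (r ^ n) (x ^ n) y := by
  induction n with
  | zero => simp [QCommute]
  | succ n ih => rw [pow_succ, pow_succ]; exact ih.mul_left h

end QCommute

/-- `a, b, c, d` satisfy the relations of `2 × 2` quantum matrices, with invertible quantum
determinant `u`. -/
structure IsQuantumGLTwo {K G : Type*} [Field K] [Ring G] [Algebra K G] (q : K) (a b c d : G)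
    (u : Gˣ) : Prop where
  ne_zero : q ≠ 0
  ab : QCommute q a b
  ac : QCommute q a c
  bd : QCommute q b d
  cd : QCommute q c d
  bc : Commute b c
  ad : a * d = u + q • (b * c)
  da : d * a = u + q⁻¹ • (b * c)

namespace IsQuantumGLTwo

variable {K G : Type*} [Field K] [Ring G] [Algebra K G] {q : K} {a b c d : G} {u : Gˣ}

theorem commute_det_a (h : IsQuantumGLTwo q a b c d u) : Commute a (u : G) := by
  have hq := h.ne_zero
  have h1 : (u : G) = d * a - q⁻¹ • (b * c) := by rw [h.da]; abel
  have h2 : (u : G) = a * d - q • (b * c) := by rw [h.ad]; abel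
  have h3 : a * (b * c) = (q * q) • (b * c * a) := h.ab.mul_right h.ac
  rw [Commute, SemiconjBy]
  conv_lhs => rw [h1]
  conv_rhs => rw [h2]
  rw [mul_sub, sub_mul, mul_smul_comm, h3, smul_smul, smul_mul_assoc, ← mul_assoc,
    ← mul_assoc, inv_mul_cancel₀ hq, one_mul]

theorem commute_det_d (h : IsQuantumGLTwo q a b c d u) : Commute d (u : G) := by
  have hq := h.ne_zero
  have h1 : (u : G) = d * a - q⁻¹ • (b * c) := by rw [h.da]; abel
  have h2 : (u : G) = a * d - q • (b * c) := by rw [h.ad]; abel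
  have h3 : b * c * d = (q * q) • (d * (b * c)) := h.bd.mul_left h.cd
  rw [Commute, SemiconjBy]
  conv_lhs => rw [h2]
  conv_rhs => rw [h1]
  rw [mul_sub, sub_mul, smul_mul_assoc, h3, smul_smul, mul_smul_comm, ← mul_assoc,
    ← mul_assoc, inv_mul_cancel_left₀ hq]

/-- An element that `q`-commutes with `a` and `d` to opposite powers of `q` and commutes with
`b * c` commutes with the quantum determinant. -/
theorem commute_det_of (h : IsQuantumGLTwo q a b c d u) {y : G} (ha : QCommute q a y)
    (hd : QCommute q y d) (hbc : Commute y (b * c)) : Commute y (u : G) := by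
  have h2 : (u : G) = a * d - q • (b * c) := by rw [h.ad]; abel
  have h3 : y * (a * d) = a * d * y := by
    have := (ha.inv_symm h.ne_zero).mul_right hd
    rwa [inv_mul_cancel₀ h.ne_zero, QCommute, one_smul] at this
  rw [h2]
  exact Commute.sub_right h3 (hbc.smul_right q)

theorem commute_det_b (h : IsQuantumGLTwo q a b c d u) : Commute b (u : G) :=
  h.commute_det_of h.ab h.bd ((Commute.refl b).mul_right h.bc)

theorem commute_det_c (h : IsQuantumGLTwo q a b c d u) : Commute c (u : G) :=
  h.commute_det_of h.ac h.cd (h.bc.symm.mul_right (Commute.refl c))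

/-- Ordered monomials with no `d`. -/
def lowMon (a b c : G) (u : Gˣ) (i j k : ℕ) (m : ℤ) : G := a ^ i * b ^ j * c ^ k * ↑(u ^ m)

/-- Ordered monomials with no `a`. -/
def highMon (b c d : G) (u : Gˣ) (j k l : ℕ) (m : ℤ) : G := b ^ j * c ^ k * d ^ l * ↑(u ^ m)

theorem lowMon_zero_eq (j k : ℕ) (m : ℤ) : lowMon a b c u 0 j k m = highMon b c d u j k 0 m := by
  simp [lowMon, highMon]

theorem a_mul_lowMon (i j k : ℕ) (m : ℤ) :
    a * lowMon a b c u i j k m = lowMon a b c u (i + 1) j k m := by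
  simp only [lowMon, ← mul_assoc, pow_succ']

theorem b_mul_highMon (j k l : ℕ) (m : ℤ) :
    b * highMon b c d u j k l m = highMon b c d u (j + 1) k l m := by
  simp only [highMon, ← mul_assoc, pow_succ']

theorem c_mul_highMon (h : IsQuantumGLTwo q a b c d u) (j k l : ℕ) (m : ℤ) :
    c * highMon b c d u j k l m = highMon b c d u j (k + 1) l m := by
  have := (h.bc.pow_left j).symm.eq
  simp only [highMon, ← mul_assoc, pow_succ', this]

theorem b_mul_lowMon (h : IsQuantumGLTwo q a b c d u) (i j k : ℕ) (m : ℤ) :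
    b * lowMon a b c u i j k m = (q⁻¹) ^ i • lowMon a b c u i (j + 1) k m := by
  have := (h.ab.inv_symm h.ne_zero).pow_right i
  unfold QCommute at this
  simp only [lowMon, ← mul_assoc, pow_succ', this, smul_mul_assoc]

theorem c_mul_lowMon (h : IsQuantumGLTwo q a b c d u) (i j k : ℕ) (m : ℤ) :
    c * lowMon a b c u i j k m = (q⁻¹) ^ i • lowMon a b c u i j (k + 1) m := by
  have h1 := ((h.ac.inv_symm h.ne_zero).pow_right i).mul_right
    ((QCommute.of_commute h.bc.symm).pow_right j)
  unfold QCommute at h1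
  rw [one_pow, mul_one] at h1
  rw [lowMon, lowMon, ← mul_assoc, ← mul_assoc, h1]
  simp only [smul_mul_assoc, mul_assoc, pow_succ']

theorem a_mul_highMon_succ (h : IsQuantumGLTwo q a b c d u) (j k l : ℕ) (m : ℤ) :
    a * highMon b c d u j k (l + 1) m = q ^ (j + k) •
      (highMon b c d u j k l (m + 1) + q • highMon b c d u (j + 1) (k + 1) l m) := by
  have h1 := (h.ab.pow_right j).mul_right (h.ac.pow_right k)
  unfold QCommute at h1
  have hu : (u : G) * d ^ l = d ^ l * u := (h.commute_det_d.pow_left l).symm.eq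
  have hbc : b ^ j * c ^ k * (b * c) = b ^ (j + 1) * c ^ (k + 1) := by
    have := (h.bc.pow_right k).eq
    rw [pow_succ, pow_succ, mul_assoc, mul_assoc, ← mul_assoc (c ^ k), ← this, mul_assoc]
  calc a * highMon b c d u j k (l + 1) m
      = (a * (b ^ j * c ^ k)) * (d * d ^ l) * ↑(u ^ m) := by
        simp only [highMon, mul_assoc, pow_succ']
    _ = q ^ (j + k) • (b ^ j * c ^ k * (a * d) * d ^ l * ↑(u ^ m)) := by
        rw [h1, pow_add]; simp only [smul_mul_assoc, mul_assoc]
    _ = q ^ (j + k) • (b ^ j * c ^ k * (↑u * d ^ l) * ↑(u ^ m)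
          + q • ((b ^ j * c ^ k * (b * c)) * d ^ l * ↑(u ^ m))) := by
        rw [h.ad]
        simp only [mul_add, add_mul, mul_smul_comm, smul_mul_assoc, mul_assoc]
    _ = _ := by
        rw [hu, hbc, add_comm m]
        simp only [highMon, zpow_one_add, Units.val_mul, mul_assoc]

theorem d_mul_highMon (h : IsQuantumGLTwo q a b c d u) (j k l : ℕ) (m : ℤ) :
    d * highMon b c d u j k l m = (q⁻¹) ^ (j + k) • highMon b c d u j k (l + 1) m := by
  have h1 := ((h.bd.inv_symm h.ne_zero).pow_right j).mul_right
    ((h.cd.inv_symm h.ne_zero).pow_right k)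
  unfold QCommute at h1
  rw [highMon, highMon, ← mul_assoc, ← mul_assoc, h1, pow_add]
  simp only [smul_mul_assoc, mul_assoc, pow_succ']

theorem commute_zpow {x : G} (hx : Commute x (u : G)) (m : ℤ) : Commute x ↑(u ^ m) :=
  hx.units_zpow_right m

theorem commute_lowMon (h : IsQuantumGLTwo q a b c d u) (i j k : ℕ) (m : ℤ) :
    Commute (u : G) (lowMon a b c u i j k m) := by
  have h1 := ((h.commute_det_a.symm.pow_right i).mul_right
    (h.commute_det_b.symm.pow_right j)).mul_right (h.commute_det_c.symm.pow_right k)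
  exact h1.mul_right (commute_zpow (.refl _) m)

theorem commute_highMon (h : IsQuantumGLTwo q a b c d u) (j k l : ℕ) (m : ℤ) :
    Commute (u : G) (highMon b c d u j k l m) := by
  have h1 := ((h.commute_det_b.symm.pow_right j).mul_right
    (h.commute_det_c.symm.pow_right k)).mul_right (h.commute_det_d.symm.pow_right l)
  exact h1.mul_right (commute_zpow (.refl _) m)

theorem inv_mul_lowMon (h : IsQuantumGLTwo q a b c d u) (i j k : ℕ) (m : ℤ) :
    ↑u⁻¹ * lowMon a b c u i j k m = lowMon a b c u i j k (m - 1) := by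
  rw [((h.commute_lowMon i j k m).units_inv_left).eq, lowMon, lowMon, zpow_sub_one, Units.val_mul]
  simp only [mul_assoc]

theorem inv_mul_highMon (h : IsQuantumGLTwo q a b c d u) (j k l : ℕ) (m : ℤ) :
    ↑u⁻¹ * highMon b c d u j k l m = highMon b c d u j k l (m - 1) := by
  rw [((h.commute_highMon j k l m).units_inv_left).eq, highMon, highMon, zpow_sub_one,
    Units.val_mul]
  simp only [mul_assoc]

theorem highMon_mul_d (h : IsQuantumGLTwo q a b c d u) (j k l : ℕ) (m : ℤ) :
    highMon b c d u j k l m * d = highMon b c d u j k (l + 1) m := by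
  rw [highMon, highMon, mul_assoc, ← (commute_zpow h.commute_det_d m).eq, pow_succ]
  simp only [mul_assoc]

theorem lowMon_mul_c (h : IsQuantumGLTwo q a b c d u) (i j k : ℕ) (m : ℤ) :
    lowMon a b c u i j k m * c = lowMon a b c u i j (k + 1) m := by
  rw [lowMon, lowMon, mul_assoc, ← (commute_zpow h.commute_det_c m).eq, pow_succ]
  simp only [mul_assoc]

theorem highMon_mul_b (h : IsQuantumGLTwo q a b c d u) (j k l : ℕ) (m : ℤ) :
    highMon b c d u j k l m * b = (q⁻¹) ^ l • highMon b c d u (j + 1) k l m := by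
  have h1 : QCommute (q ^ l) b (highMon b c d u j k l m) := by
    have := (((QCommute.of_commute (.pow_right (.refl b) j)).mul_right
      (.of_commute (h.bc.pow_right k))).mul_right (h.bd.pow_right l)).mul_right
      (.of_commute (commute_zpow h.commute_det_b m))
    simpa only [one_mul, mul_one, highMon] using this
  rw [← b_mul_highMon, h1, smul_smul, ← mul_pow, inv_mul_cancel₀ h.ne_zero, one_pow, one_smul]

theorem lowMon_mul_a (h : IsQuantumGLTwo q a b c d u) (i j k : ℕ) (m : ℤ) :
    lowMon a b c u i j k m * a = (q⁻¹) ^ (j + k) • lowMon a b c u (i + 1) j k m := by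
  have h1 : QCommute (q ^ (j + k)) a (lowMon a b c u i j k m) := by
    have := (((QCommute.of_commute (.pow_right (.refl a) i)).mul_right
      (h.ab.pow_right j)).mul_right (h.ac.pow_right k)).mul_right
      (.of_commute (commute_zpow h.commute_det_a m))
    simpa only [one_mul, mul_one, ← pow_add, lowMon] using this
  rw [← a_mul_lowMon, h1, smul_smul, ← mul_pow, inv_mul_cancel₀ h.ne_zero, one_pow, one_smul]

theorem mul_lowMon (h : IsQuantumGLTwo q a b c d u) (i j k : ℕ) (m : ℤ) :
    (u : G) * lowMon a b c u i j k m = lowMon a b c u i j k (m + 1) := by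
  rw [(h.commute_lowMon i j k m).eq, lowMon, lowMon, zpow_add_one, Units.val_mul]
  simp only [mul_assoc]

theorem d_mul_lowMon_succ (h : IsQuantumGLTwo q a b c d u) (i j k : ℕ) (m : ℤ) :
    d * lowMon a b c u (i + 1) j k m = lowMon a b c u i j k (m + 1) +
      q⁻¹ • (b * (c * lowMon a b c u i j k m)) := by
  rw [← a_mul_lowMon, ← mul_assoc, h.da, add_mul, h.mul_lowMon, smul_mul_assoc, mul_assoc]

/-- The ordered monomials span any algebra generated by `a, b, c, d` and `u⁻¹`. -/
theorem mem_of_forall_mon_mem (h : IsQuantumGLTwo q a b c d u) {s : Set G}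
    (hgen : Algebra.adjoin K s = ⊤) (hs : s ⊆ {a, b, c, d, ↑u⁻¹}) {W : Submodule K G}
    (hlow : ∀ i j k m, lowMon a b c u i j k m ∈ W)
    (hhigh : ∀ j k l m, highMon b c d u j k l m ∈ W) (f : G) : f ∈ W := by
  let P : Submodule K G := Submodule.span K ({f | ∃ i j k m, f = lowMon a b c u i j k m} ∪
    {f | ∃ j k l m, f = highMon b c d u j k l m})
  have hPW : P ≤ W := by
    refine Submodule.span_le.2 ?_
    rintro _ (⟨i, j, k, m, rfl⟩ | ⟨j, k, l, m, rfl⟩)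
    exacts [hlow _ _ _ _, hhigh _ _ _ _]
  have pl : ∀ i j k m, lowMon a b c u i j k m ∈ P := fun i j k m =>
    Submodule.subset_span (.inl ⟨i, j, k, m, rfl⟩)
  have ph : ∀ j k l m, highMon b c d u j k l m ∈ P := fun j k l m =>
    Submodule.subset_span (.inr ⟨j, k, l, m, rfl⟩)
  have closed : ∀ y : G, (∀ i j k m, y * lowMon a b c u i j k m ∈ P) →
      (∀ j k l m, y * highMon b c d u j k l m ∈ P) → ∀ p ∈ P, y * p ∈ P := by
    intro y h1 h2 p hp
    have : P ≤ P.comap (LinearMap.mulLeft K y) := by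
      refine Submodule.span_le.2 ?_
      rintro _ (⟨i, j, k, m, rfl⟩ | ⟨j, k, l, m, rfl⟩)
      exacts [h1 _ _ _ _, h2 _ _ _ _]
    exact this hp
  have hb : ∀ p ∈ P, b * p ∈ P := closed b
    (fun i j k m => by rw [h.b_mul_lowMon]; exact P.smul_mem _ (pl _ _ _ _))
    (fun j k l m => by rw [b_mul_highMon]; exact ph _ _ _ _)
  have hc : ∀ p ∈ P, c * p ∈ P := closed c
    (fun i j k m => by rw [h.c_mul_lowMon]; exact P.smul_mem _ (pl _ _ _ _))
    (fun j k l m => by rw [h.c_mul_highMon]; exact ph _ _ _ _)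
  have ha : ∀ p ∈ P, a * p ∈ P := closed a
    (fun i j k m => by rw [a_mul_lowMon]; exact pl _ _ _ _)
    (fun j k l m => by
      cases l with
      | zero => rw [← lowMon_zero_eq (a := a), a_mul_lowMon]; exact pl _ _ _ _
      | succ l =>
        rw [h.a_mul_highMon_succ]
        exact P.smul_mem _ (P.add_mem (ph _ _ _ _) (P.smul_mem _ (ph _ _ _ _))))
  have hd : ∀ p ∈ P, d * p ∈ P := closed d
    (fun i j k m => by
      cases i with
      | zero => rw [lowMon_zero_eq (d := d), h.d_mul_highMon]; exact P.smul_mem _ (ph _ _ _ _)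
      | succ i =>
        rw [h.d_mul_lowMon_succ]
        exact P.add_mem (pl _ _ _ _) (P.smul_mem _ (hb _ (hc _ (pl _ _ _ _)))))
    (fun j k l m => by rw [h.d_mul_highMon]; exact P.smul_mem _ (ph _ _ _ _))
  have hu : ∀ p ∈ P, ↑u⁻¹ * p ∈ P := closed _
    (fun i j k m => by
      rw [h.inv_mul_lowMon]; exact pl _ _ _ _)
    (fun j k l m => by
      rw [h.inv_mul_highMon]; exact ph _ _ _ _)
  have key : ∀ g ∈ Algebra.adjoin K s, ∀ p ∈ P, g * p ∈ P := by
    intro g hg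
    induction hg using Algebra.adjoin_induction with
    | mem y hy =>
      rcases hs hy with rfl | rfl | rfl | rfl | rfl
      exacts [ha, hb, hc, hd, hu]
    | algebraMap r => intro p hp; rw [← Algebra.smul_def]; exact P.smul_mem _ hp
    | add y z _ _ hy hz => intro p hp; rw [add_mul]; exact P.add_mem (hy p hp) (hz p hp)
    | mul y z _ _ hy hz => intro p hp; rw [mul_assoc]; exact hy _ (hz p hp)
  have h1 : (1 : G) ∈ P := by simpa [lowMon] using pl 0 0 0 0
  simpa using hPW (key f (hgen ▸ Algebra.mem_top) 1 h1)

/-- `V` contains `1` and is stable under the operators through which right multiplication by the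
generators acts on the image of the co-orbit map. -/
structure IsCoorbitClosed (q : K) (a b c d : G) (u : Gˣ) (ξ1 ξ2 : K) (V : Submodule K G) :
    Prop where
  one_mem : 1 ∈ V
  mem_b : ∀ f ∈ V, ↑u⁻¹ * (ξ1 • (d * f * b) - (q⁻¹ * ξ2) • (b * f * d)) ∈ V
  mem_c : ∀ f ∈ V, ↑u⁻¹ * (ξ2 • (a * f * c) - (q * ξ1) • (c * f * a)) ∈ V
  mem_d : ∀ f ∈ V, ↑u⁻¹ * (ξ2 • (a * f * d) - (q * ξ1) • (c * f * b)) ∈ V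

section Closed

variable {ξ1 ξ2 : K} {V : Submodule K G}

theorem highMon_diag_mem (h : IsQuantumGLTwo q a b c d u)
    (hV : IsCoorbitClosed q a b c d u ξ1 ξ2 V) (hsep : ∀ k : ℕ, ξ1 - q ^ (2 * k) * ξ2 ≠ 0)
    (n : ℕ) : highMon b c d u n n 0 (-n) ∈ V := by
  induction n with
  | zero => simpa [highMon] using hV.one_mem
  | succ n ih =>
    have key := hV.mem_d _ ih
    rw [mul_assoc, h.highMon_mul_d, h.a_mul_highMon_succ, h.c_mul_highMon, h.highMon_mul_b,
      pow_zero, one_smul, mul_sub, mul_smul_comm, mul_smul_comm, mul_smul_comm, mul_add,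
      mul_smul_comm, h.inv_mul_highMon, h.inv_mul_highMon, add_sub_cancel_right, smul_add, smul_add,
      add_sub_assoc, V.add_mem_iff_right (V.smul_mem _ (V.smul_mem _ ih)), smul_smul, smul_smul,
      ← sub_smul] at key
    have e : (-(n : ℤ)) - 1 = -((n + 1 : ℕ) : ℤ) := by push_cast; ring
    rw [e] at key
    refine (V.smul_mem_iff (s := ξ2 * q ^ (n + n) * q - q * ξ1) ?_).1 key
    rw [show ξ2 * q ^ (n + n) * q - q * ξ1 = -q * (ξ1 - q ^ (2 * n) * ξ2) by ring]
    exact mul_ne_zero (neg_ne_zero.2 h.ne_zero) (hsep n)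

theorem lowMon_weight_zero_mem (h : IsQuantumGLTwo q a b c d u)
    (hV : IsCoorbitClosed q a b c d u ξ1 ξ2 V) (hsep : ∀ k : ℕ, ξ1 - q ^ (2 * k) * ξ2 ≠ 0)
    (i j : ℕ) : lowMon a b c u i j (i + j) (-(i + j : ℕ)) ∈ V := by
  induction i with
  | zero => rw [lowMon_zero_eq (d := d), zero_add]; exact h.highMon_diag_mem hV hsep j
  | succ i ih =>
    have key := hV.mem_c _ ih
    have e : (-((i + j : ℕ) : ℤ)) - 1 = -((i + 1 + j : ℕ) : ℤ) := by push_cast; ring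
    rw [a_mul_lowMon, h.lowMon_mul_c, h.c_mul_lowMon, smul_mul_assoc, h.lowMon_mul_a, smul_smul,
      smul_smul, ← sub_smul, mul_smul_comm, h.inv_mul_lowMon, e,
      show i + j + 1 = i + 1 + j by ring] at key
    refine (V.smul_mem_iff ?_).1 key
    have hq := h.ne_zero
    have : ξ2 - q * ξ1 * q⁻¹ ^ i * q⁻¹ ^ (j + (i + 1 + j)) =
        -(q⁻¹ ^ (2 * (i + j))) * (ξ1 - q ^ (2 * (i + j)) * ξ2) := by
      simp only [inv_pow]
      field_simp
      ring
    rw [this]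
    exact mul_ne_zero (neg_ne_zero.2 (pow_ne_zero _ (inv_ne_zero hq))) (hsep _)

theorem highMon_weight_zero_mem (h : IsQuantumGLTwo q a b c d u)
    (hV : IsCoorbitClosed q a b c d u ξ1 ξ2 V) (hsep : ∀ k : ℕ, ξ1 - q ^ (2 * k) * ξ2 ≠ 0)
    (k l : ℕ) : highMon b c d u (k + l) k l (-(k + l : ℕ)) ∈ V := by
  induction l with
  | zero => exact h.highMon_diag_mem hV hsep k
  | succ l ih =>
    have key := hV.mem_b _ ih
    have e : (-((k + l : ℕ) : ℤ)) - 1 = -((k + (l + 1) : ℕ) : ℤ) := by push_cast; ring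
    rw [b_mul_highMon, h.highMon_mul_d, h.d_mul_highMon, smul_mul_assoc, h.highMon_mul_b,
      smul_smul, smul_smul, ← sub_smul, mul_smul_comm, h.inv_mul_highMon, e] at key
    refine (V.smul_mem_iff ?_).1 key
    have hq := h.ne_zero
    have : ξ1 * q⁻¹ ^ (k + l + k) * q⁻¹ ^ (l + 1) - q⁻¹ * ξ2 =
        q⁻¹ ^ (2 * (k + l) + 1) * (ξ1 - q ^ (2 * (k + l)) * ξ2) := by
      simp only [inv_pow]
      field_simp
      ring
    rw [this]
    exact mul_ne_zero (pow_ne_zero _ (inv_ne_zero hq)) (hsep _)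

end Closed

end IsQuantumGLTwo

theorem qdet_fin_two {A M : Type} [CommRing A] [Ring M] [Algebra A M] (q : A)
    (x : Fin 2 → Fin 2 → M) : qdet q x = x 0 0 * x 1 1 - q • (x 0 1 * x 1 0) := by
  have h (k : Fin 2) :
      ((Finset.univ : Finset (Fin 2)).orderIsoOfFin (Finset.card_fin 2) k).1 = k :=
    (congrFun (Finset.orderEmbOfFin_unique (s := Finset.univ) (Finset.card_fin 2) (f := id)
      (fun _ => Finset.mem_univ _) strictMono_id) k).symm
  have h0 : invCount (1 : Equiv.Perm (Fin 2)) = 0 := by decide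
  have h1 : invCount (Equiv.swap (0 : Fin 2) 1) = 1 := by decide
  change ∑ σ : Equiv.Perm (Fin 2), (-q) ^ invCount σ • ((List.finRange 2).map fun k =>
    x ((Finset.univ : Finset (Fin 2)).orderIsoOfFin (Finset.card_fin 2) k).1
      ((Finset.univ : Finset (Fin 2)).orderIsoOfFin (Finset.card_fin 2) (σ k)).1).prod = _
  have hp : (Finset.univ : Finset (Equiv.Perm (Fin 2))) = {1, Equiv.swap 0 1} := by decide
  simp only [h, hp, List.finRange_succ, List.finRange_zero]
  rw [Finset.sum_pair (by decide), h0, h1]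
  simp [sub_eq_add_neg]

section Coorbit

variable {K M G : Type} [Field K] [Ring M] [Ring G] [Algebra K G]

open Coalgebra LinearMap WithConv in
/-- If `s` is the convolution inverse of the algebra map `ι` on a bialgebra containing a
`2 × 2` matrix coalgebra `x`, then `s` is antimultiplicative with respect to the entries of `x`. -/
theorem convInverse_mul_entry [Bialgebra K M] {x : Fin 2 → Fin 2 → M}
    (hΔ : ∀ i j, comul (R := K) (x i j) = ∑ k, x i k ⊗ₜ[K] x k j)
    (hε : ∀ i j, counit (R := K) (x i j) = if i = j then 1 else 0)
    (ι : M →ₐ[K] G) (s : M →ₗ[K] G)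
    (hl : toConv s * toConv ι.toLinearMap = 1) (hr : toConv ι.toLinearMap * toConv s = 1)
    {κ : Fin 2 → Fin 2 → G}
    (hκ : ∀ i l, ∑ j, ι (x i j) * κ j l = if i = l then 1 else 0) (m : M) (i l : Fin 2) :
    s (m * x i l) = κ i l * s m := by
  let v : Fin 2 → Fin 2 → WithConv (M →ₗ[K] G) := fun i k => toConv (s ∘ₗ mulRight K (x i k))
  have h1 : ∀ g i j, ∑ k, (v i k * toConv ι.toLinearMap) g * ι (x k j) =
      counit (R := K) g • if i = j then (1 : G) else 0 := by
    intro g i j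
    have h0 := congrArg (fun f : WithConv (M →ₗ[K] G) => f (g * x i j)) hl
    simp only [convMul_apply, convOne_apply, Bialgebra.comul_mul, Bialgebra.counit_mul, hΔ, hε]
      at h0
    trans algebraMap K G (counit g * if i = j then 1 else 0)
    · rw [← h0]
      simp only [convMul_apply]
      generalize (comul g : M ⊗[K] M) = w
      induction w with
      | zero => simp
      | add y z hy hz =>
        simp only [map_add, add_mul, Finset.sum_add_distrib] at hy hz ⊢
        rw [hy, hz]
      | tmul y z => simp [v, mul_add, mul_assoc]
    · split_ifs <;> simp [Algebra.algebraMap_eq_smul_one]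
  have h2 : v i l * toConv ι.toLinearMap = toConv (mulLeft K (κ i l) ∘ₗ Algebra.linearMap K G ∘ₗ
      counit) := by
    ext g
    have := congrArg₂ (fun y z => y * κ 0 l + z * κ 1 l) (h1 g i 0) (h1 g i 1)
    have e0 := hκ 0 l
    have e1 := hκ 1 l
    simp only [Fin.sum_univ_two, add_mul, mul_assoc] at this e0 e1
    rw [add_add_add_comm, ← mul_add, ← mul_add, e0, e1] at this
    fin_cases i <;> fin_cases l <;> simpa [Algebra.algebraMap_eq_smul_one] using this
  have h3 : v i l = toConv (mulLeft K (κ i l) ∘ₗ s) := by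
    rw [← mul_one (v i l), ← hr, ← mul_assoc, h2]
    have : toConv (mulLeft K (κ i l) ∘ₗ Algebra.linearMap K G ∘ₗ counit) * toConv s =
        toConv (mulLeft K (κ i l) ∘ₗ (1 * toConv s : WithConv (M →ₗ[K] G)).ofConv) := by
      ext g
      simp only [convMul_apply, coe_comp, Function.comp_apply, mulLeft_apply]
      generalize (comul g : M ⊗[K] M) = w
      induction w with
      | zero => simp
      | add y z hy hz => simp only [map_add, mul_add] at hy hz ⊢; rw [hy, hz]
      | tmul y z => simp [mul_assoc, LinearMap.convOne_def]
    rw [this, one_mul]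
  exact congrArg (fun f : WithConv (M →ₗ[K] G) => f m) h3

/-- The effect on the co-orbit map of right multiplication by a matrix entry. -/
theorem coorbit_mul_entry [Algebra K M] {x : Fin 2 → Fin 2 → M} {ΔM : M →ₐ[K] M ⊗[K] M}
    (hΔ : ∀ i j, ΔM (x i j) = ∑ k, x i k ⊗ₜ[K] x k j) {ι : M →ₐ[K] G} {St : G →ₗ[K] G}
    {κ : Fin 2 → Fin 2 → G} (hS : ∀ m i l, St (ι (m * x i l)) = κ i l * St (ι m))
    {e : M →ₐ[K] K} {ξ : Fin 2 → K} (he : ∀ i j, e (x i j) = if i = j then ξ i else 0)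
    (h : M) (i j : Fin 2) :
    coorbit e (adjBeta ΔM ι St) (h * x i j) =
      ∑ k, ξ k • (κ i k * coorbit e (adjBeta ΔM ι St) h * ι (x k j)) := by
  simp only [coorbit, adjBeta, LinearMap.comp_apply, AlgHom.toLinearMap_apply, map_mul, hΔ]
  generalize ΔM h = w
  induction w with
  | zero => simp
  | add y z hy hz =>
    simp only [map_add, add_mul, mul_add, smul_add, Finset.sum_add_distrib] at hy hz ⊢
    rw [hy, hz]
  | tmul y z =>
    simp only [Finset.mul_sum, map_sum, Algebra.TensorProduct.tmul_mul_tmul, map_mul,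
      TensorProduct.map_tmul, AlgHom.toLinearMap_apply, hΔ, LinearMap.id_apply]
    generalize ΔM y = w
    induction w with
    | zero => simp
    | add y z hy hz =>
      simp only [map_add, add_mul, mul_add, smul_add, Finset.sum_add_distrib, add_tmul] at hy hz ⊢
      rw [hy, hz]
    | tmul y y' =>
      have hS' : ∀ m i l, St (ι m * ι (x i l)) = κ i l * St (ι m) := fun m i l => by
        rw [← map_mul, hS]
      simp [add_tmul, he, hS', mul_assoc, smul_smul, mul_comm]

end Coorbit

section Antipode

variable {K M G : Type} [Field K] [Ring M] [Ring G] [Algebra K M] [Algebra K G]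

open LinearMap WithConv in
/-- The antipode of a bialgebra `G` is antimultiplicative with respect to the entries of a quantum
matrix. -/
theorem antipode_mul_entry {x : Fin 2 → Fin 2 → M}
    (hgen : Algebra.adjoin K (Set.range fun p : Fin 2 × Fin 2 => x p.1 p.2) = ⊤)
    {ΔM : M →ₐ[K] M ⊗[K] M} (hΔM : ∀ i j, ΔM (x i j) = ∑ k, x i k ⊗ₜ[K] x k j)
    {ι : M →ₐ[K] G} {ΔG : G →ₐ[K] G ⊗[K] G}
    (hΔG : ∀ m, ΔG (ι m) = Algebra.TensorProduct.map ι ι (ΔM m))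
    {εG : G →ₐ[K] K} (hεG : ∀ i j, εG (ι (x i j)) = if i = j then 1 else 0)
    {St : G →ₗ[K] G}
    (hS1 : LinearMap.mul' K G ∘ₗ TensorProduct.map St LinearMap.id ∘ₗ ΔG.toLinearMap
      = Algebra.linearMap K G ∘ₗ εG.toLinearMap)
    (hS2 : LinearMap.mul' K G ∘ₗ TensorProduct.map LinearMap.id St ∘ₗ ΔG.toLinearMap
      = Algebra.linearMap K G ∘ₗ εG.toLinearMap)
    {κ : Fin 2 → Fin 2 → G}
    (hκ : ∀ i l, ∑ j, ι (x i j) * κ j l = if i = l then 1 else 0) (m : M) (i l : Fin 2) :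
    St (ι (m * x i l)) = κ i l * St (ι m) := by
  have hgen_ext {B : Type} [Semiring B] [Algebra K B] {φ ψ : M →ₐ[K] B}
      (h : ∀ i j, φ (x i j) = ψ (x i j)) : φ = ψ :=
    AlgHom.ext_of_adjoin_eq_top hgen (by rintro _ ⟨p, rfl⟩; exact h p.1 p.2)
  let : Bialgebra K M := Bialgebra.ofAlgHom ΔM (εG.comp ι)
    (hgen_ext fun i j => by
      simp [hΔM, add_tmul, tmul_add]
      abel)
    (hgen_ext fun i j => by
      fin_cases i <;> simp [hΔM, hεG])
    (hgen_ext fun i j => by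
      fin_cases j <;> simp [hΔM, hεG])
  have hcomul (g : M) : Coalgebra.comul (R := K) g = ΔM g := rfl
  have hcounit (g : M) : Coalgebra.counit (R := K) g = εG (ι g) := rfl
  refine convInverse_mul_entry hΔM hεG ι (St ∘ₗ ι.toLinearMap) ?_ ?_ hκ m i l
  · ext g
    have h := LinearMap.congr_fun hS1 (ι g)
    simp only [convMul_apply, convOne_apply, hcomul, hcounit]
    simp only [LinearMap.comp_apply, AlgHom.toLinearMap_apply, hΔG, Algebra.linearMap_apply] at h
    rw [← h]
    generalize ΔM g = w
    induction w with
    | zero => simp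
    | add y z hy hz => simp only [map_add, hy, hz]
    | tmul y z => simp
  · ext g
    have h := LinearMap.congr_fun hS2 (ι g)
    simp only [convMul_apply, convOne_apply, hcomul, hcounit]
    simp only [LinearMap.comp_apply, AlgHom.toLinearMap_apply, hΔG, Algebra.linearMap_apply] at h
    rw [← h]
    generalize ΔM g = w
    induction w with
    | zero => simp
    | add y z hy hz => simp only [map_add, hy, hz]
    | tmul y z => simp

end Antipode

/-- The entries of the antipode of a `2 × 2` quantum matrix. -/
def antipodeEntry {K G : Type} [Field K] [Ring G] [Algebra K G] (q : K) (a b c d : G) (u : Gˣ) :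
    Fin 2 → Fin 2 → G :=
  ![![↑u⁻¹ * d, -(q⁻¹ • (↑u⁻¹ * b))], ![-(q • (↑u⁻¹ * c)), ↑u⁻¹ * a]]

section Weight

variable {K G D : Type*} [Field K] [Ring G] [Algebra K G] [CommRing D] [Algebra K D]

theorem map_zpow_eq_tmul {L : G →ₐ[K] D ⊗[K] G} {τ : Dˣ} {u : Gˣ}
    (h : L u = (τ : D) ⊗ₜ (u : G)) (m : ℤ) :
    L ↑(u ^ m) = ((τ ^ m : Dˣ) : D) ⊗ₜ[K] ((u ^ m : Gˣ) : G) := by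
  let f : Dˣ →* (D ⊗[K] G)ˣ := Units.map (Algebra.TensorProduct.includeLeft : D →ₐ[K] D ⊗[K] G)
  let g : Gˣ →* (D ⊗[K] G)ˣ := Units.map (Algebra.TensorProduct.includeRight : G →ₐ[K] D ⊗[K] G)
  have h1 : Units.map (L : G →* D ⊗[K] G) u = f τ * g u := by
    ext; simp [f, g, h]
  have h2 : Commute (f τ) (g u) := by
    ext; simp [f, g]
  have h3 : Units.map (L : G →* D ⊗[K] G) (u ^ m) = f (τ ^ m) * g (u ^ m) := by
    rw [map_zpow, h1, h2.mul_zpow, map_zpow, map_zpow]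
  calc L ↑(u ^ m) = ((f (τ ^ m) * g (u ^ m) : (D ⊗[K] G)ˣ) : D ⊗[K] G) := congrArg Units.val h3
    _ = _ := by
      change (((τ ^ m : Dˣ) : D) ⊗ₜ[K] (1 : G)) * ((1 : D) ⊗ₜ[K] ((u ^ m : Gˣ) : G)) = _
      rw [Algebra.TensorProduct.tmul_mul_tmul, mul_one, one_mul]

/-- The left torus coaction for which the two rows of a quantum matrix have weights `τ₀, τ₁`. -/
structure IsRowCoaction (L : G →ₐ[K] D ⊗[K] G) (a b c d : G) (τ₀ τ₁ : Dˣ) : Prop where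
  map_a : L a = (τ₀ : D) ⊗ₜ a
  map_b : L b = (τ₀ : D) ⊗ₜ b
  map_c : L c = (τ₁ : D) ⊗ₜ c
  map_d : L d = (τ₁ : D) ⊗ₜ d

namespace IsRowCoaction

variable {L : G →ₐ[K] D ⊗[K] G} {q : K} {a b c d : G} {τ₀ τ₁ : Dˣ} {u : Gˣ}

open IsQuantumGLTwo

theorem map_det (hL : IsRowCoaction L a b c d τ₀ τ₁) (h : IsQuantumGLTwo q a b c d u) :
    L u = ((τ₀ * τ₁ : Dˣ) : D) ⊗ₜ (u : G) := by
  have hu : (u : G) = a * d - q • (b * c) := by rw [h.ad]; abel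
  rw [hu]
  simp [hL.map_a, hL.map_b, hL.map_c, hL.map_d, tmul_sub]

theorem map_lowMon (hL : IsRowCoaction L a b c d τ₀ τ₁) (h : IsQuantumGLTwo q a b c d u)
    (i j k : ℕ) (m : ℤ) : L (lowMon a b c u i j k m) =
      ((τ₀ ^ (i + j + m) * τ₁ ^ (k + m) : Dˣ) : D) ⊗ₜ lowMon a b c u i j k m := by
  have : (τ₀ ^ (i + j + m) * τ₁ ^ (k + m) : Dˣ) =
      τ₀ ^ i * τ₀ ^ j * τ₁ ^ k * (τ₀ * τ₁) ^ m := by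
    simp only [zpow_add, zpow_natCast, mul_zpow]
    ac_rfl
  rw [this]
  simp only [lowMon, map_mul, map_pow, hL.map_a, hL.map_b, hL.map_c,
    map_zpow_eq_tmul (hL.map_det h), Algebra.TensorProduct.tmul_pow,
    Algebra.TensorProduct.tmul_mul_tmul, Units.val_mul, Units.val_pow_eq_pow_val]

theorem map_highMon (hL : IsRowCoaction L a b c d τ₀ τ₁) (h : IsQuantumGLTwo q a b c d u)
    (j k l : ℕ) (m : ℤ) : L (highMon b c d u j k l m) =
      ((τ₀ ^ (j + m) * τ₁ ^ (k + l + m) : Dˣ) : D) ⊗ₜ highMon b c d u j k l m := by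
  have : (τ₀ ^ (j + m) * τ₁ ^ (k + l + m) : Dˣ) =
      τ₀ ^ j * τ₁ ^ k * τ₁ ^ l * (τ₀ * τ₁) ^ m := by
    simp only [zpow_add, zpow_natCast, mul_zpow]
    ac_rfl
  rw [this]
  simp only [highMon, map_mul, map_pow, hL.map_b, hL.map_c, hL.map_d,
    map_zpow_eq_tmul (hL.map_det h), Algebra.TensorProduct.tmul_pow,
    Algebra.TensorProduct.tmul_mul_tmul, Units.val_mul, Units.val_pow_eq_pow_val]

/-- A coinvariant element lies in every subspace that contains the ordered monomials of weight
zero. -/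
theorem mem_of_coinvariant (hL : IsRowCoaction L a b c d τ₀ τ₁)
    (h : IsQuantumGLTwo q a b c d u) {s : Set G} (hgen : Algebra.adjoin K s = ⊤)
    (hs : s ⊆ {a, b, c, d, ↑u⁻¹}) {p : D →ₗ[K] K}
    (hp : ∀ i j : ℤ, p ↑(τ₀ ^ i * τ₁ ^ j) = if i = 0 ∧ j = 0 then 1 else 0)
    {V : Submodule K G}
    (hlow : ∀ i j : ℕ, lowMon a b c u i j (i + j) (-(i + j : ℕ)) ∈ V)
    (hhigh : ∀ k l : ℕ, highMon b c d u (k + l) k l (-(k + l : ℕ)) ∈ V)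
    {f : G} (hf : L f = (1 : D) ⊗ₜ f) : f ∈ V := by
  let R : G →ₗ[K] G :=
    (TensorProduct.lid K G).toLinearMap ∘ₗ TensorProduct.map p LinearMap.id ∘ₗ L.toLinearMap
  have hR : R f ∈ V := by
    refine h.mem_of_forall_mon_mem hgen hs (W := V.comap R) (fun i j k m => ?_)
      (fun j k l m => ?_) f
    · have e : R (lowMon a b c u i j k m) =
          (if (i + j + m : ℤ) = 0 ∧ (k + m : ℤ) = 0 then (1 : K) else 0) •
            lowMon a b c u i j k m := by
        simp only [R, LinearMap.comp_apply, AlgHom.toLinearMap_apply, hL.map_lowMon h,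
          TensorProduct.map_tmul, hp, LinearMap.id_apply, LinearEquiv.coe_coe,
          TensorProduct.lid_tmul]
      rw [Submodule.mem_comap, e]
      split_ifs with hw
      · obtain rfl : m = -(i + j : ℕ) := by omega
        obtain rfl : k = i + j := by omega
        exact V.smul_mem _ (hlow i j)
      · simp
    · have e : R (highMon b c d u j k l m) =
          (if (j + m : ℤ) = 0 ∧ (k + l + m : ℤ) = 0 then (1 : K) else 0) •
            highMon b c d u j k l m := by
        simp only [R, LinearMap.comp_apply, AlgHom.toLinearMap_apply, hL.map_highMon h,
          TensorProduct.map_tmul, hp, LinearMap.id_apply, LinearEquiv.coe_coe,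
          TensorProduct.lid_tmul]
      rw [Submodule.mem_comap, e]
      split_ifs with hw
      · obtain rfl : m = -(k + l : ℕ) := by omega
        obtain rfl : j = k + l := by omega
        exact V.smul_mem _ (hhigh k l)
      · simp
  have hp1 : p 1 = 1 := by simpa using hp 0 0
  simpa [R, hf, hp1] using hR

/-- Multiplying a coinvariant element by one entry from each row and dividing by the determinant
gives a coinvariant element. -/
theorem map_inv_mul (hL : IsRowCoaction L a b c d τ₀ τ₁) (h : IsQuantumGLTwo q a b c d u)
    {f y z : G} (hf : L f = (1 : D) ⊗ₜ f)
    (hyz : L y = (τ₀ : D) ⊗ₜ y ∧ L z = (τ₁ : D) ⊗ₜ z ∨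
      L y = (τ₁ : D) ⊗ₜ y ∧ L z = (τ₀ : D) ⊗ₜ z) :
    L (↑u⁻¹ * y * f * z) = (1 : D) ⊗ₜ (↑u⁻¹ * y * f * z) := by
  have hu := map_zpow_eq_tmul (hL.map_det h) (-1)
  rw [zpow_neg_one, zpow_neg_one] at hu
  rcases hyz with ⟨hy, hz⟩ | ⟨hy, hz⟩ <;>
  · simp only [map_mul, hu, hf, hy, hz, Algebra.TensorProduct.tmul_mul_tmul, mul_one,
      ← Units.val_mul]
    congr 1
    simp [mul_comm]

end IsRowCoaction

/-- The functional reading off the coefficient of `1` on the coordinate ring of a torus. -/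
theorem exists_torus_functional {K D : Type} [Field K] [CommRing D] [Algebra K D] (t : Fin 2 → Dˣ)
    (hfree : ∀ (B : Type) [CommRing B] [Algebra K B] (v : Fin 2 → Bˣ),
      ∃! φ : D →ₐ[K] B, ∀ i, φ (t i : D) = (v i : B)) :
    ∃ p : D →ₗ[K] K, ∀ i j : ℤ, p ↑(t 0 ^ i * t 1 ^ j) = if i = 0 ∧ j = 0 then 1 else 0 := by
  let Λ := Multiplicative ℤ × Multiplicative ℤ
  let of : Λ →* (MonoidAlgebra K Λ)ˣ := (Units.map (MonoidAlgebra.of K Λ)).comp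
    (toUnits (G := Λ)).toMonoidHom
  obtain ⟨φ, hφ, -⟩ := hfree (MonoidAlgebra K Λ)
    ![of (Multiplicative.ofAdd 1, 1), of (1, Multiplicative.ofAdd 1)]
  refine ⟨Finsupp.lapply 1 ∘ₗ (MonoidAlgebra.coeffLinearEquiv K).toLinearMap ∘ₗ φ.toLinearMap,
    fun i j => ?_⟩
  have h0 : Units.map (φ : D →* MonoidAlgebra K Λ) (t 0) = of (Multiplicative.ofAdd 1, 1) :=
    Units.ext (hφ 0)
  have h1 : Units.map (φ : D →* MonoidAlgebra K Λ) (t 1) = of (1, Multiplicative.ofAdd 1) :=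
    Units.ext (hφ 1)
  have h2 : φ ↑(t 0 ^ i * t 1 ^ j) =
      MonoidAlgebra.of K Λ (Multiplicative.ofAdd i, Multiplicative.ofAdd j) := by
    have : Units.map (φ : D →* MonoidAlgebra K Λ) (t 0 ^ i * t 1 ^ j) =
        of (Multiplicative.ofAdd i, Multiplicative.ofAdd j) := by
      rw [map_mul, map_zpow, map_zpow, h0, h1, ← map_zpow, ← map_zpow, ← map_mul]
      congr 1
      refine Prod.ext ?_ ?_
      · change Multiplicative.ofAdd (1 : ℤ) ^ i * 1 ^ j = Multiplicative.ofAdd i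
        simp [← ofAdd_zsmul]
      · change 1 ^ i * Multiplicative.ofAdd (1 : ℤ) ^ j = Multiplicative.ofAdd j
        simp [← ofAdd_zsmul]
    exact congrArg Units.val this
  have h3 : ((Multiplicative.ofAdd i, Multiplicative.ofAdd j) : Λ) = 1 ↔ i = 0 ∧ j = 0 := by
    rw [Prod.ext_iff]; simp
  simp only [LinearMap.comp_apply, AlgHom.toLinearMap_apply, h2]
  simp [Finsupp.single_apply, h3]

end Weight

theorem IsQuantumGLTwo.sum_mul_antipodeEntry {K G : Type} [Field K] [Ring G] [Algebra K G] {q : K}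
    {a b c d : G} {u : Gˣ} (h : IsQuantumGLTwo q a b c d u) {X : Fin 2 → Fin 2 → G}
    (h00 : X 0 0 = a) (h01 : X 0 1 = b) (h10 : X 1 0 = c) (h11 : X 1 1 = d) (i l : Fin 2) :
    ∑ j, X i j * antipodeEntry q a b c d u j l = if i = l then 1 else 0 := by
  have hinv {y : G} (hy : Commute y (u : G)) (z : G) : y * (↑u⁻¹ * z) = ↑u⁻¹ * (y * z) := by
    rw [← mul_assoc, ← mul_assoc, hy.units_inv_right.eq]
  have hq := h.ne_zero
  have hab : a * b = q • (b * a) := h.ab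
  have hcd : c * d = q • (d * c) := h.cd
  fin_cases i <;> fin_cases l <;>
    simp only [antipodeEntry, Fin.sum_univ_two, Fin.zero_eta, Fin.mk_one, Matrix.cons_val_zero,
      Matrix.cons_val_one, h00, h01, h10, h11, mul_neg, mul_smul_comm, hinv h.commute_det_a,
      hinv h.commute_det_b, hinv h.commute_det_c, hinv h.commute_det_d, h.ad, h.da, hab, hcd,
      h.bc.eq, mul_add, smul_smul] <;>
    simp [hq]

/-- `N = 2`, `q` not a root of unity, `ξ = diag(ξ₁, ξ₂)` with `ξ₁ - q^(2k) ξ₂ ≠ 0`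
for all `k ≥ 0`: the image of `β^ξ` is exactly `O(D\GL_q)`. -/
theorem image_coorbit_beta_2x2
    (q : ℂ) (hq : q ≠ 0) (hqru : (∀ n : ℕ, 0 < n → q ^ n ≠ 1) ∨ q = 1)
    (M G : Type) [Ring M] [Algebra ℂ M] [Ring G] [Algebra ℂ G]
    (x : Fin 2 → Fin 2 → M)
    (hrow : ∀ i j l : Fin 2, j < l → x i j * x i l = (q) • (x i l * x i j))
    (hcol : ∀ i k j : Fin 2, i < k → x i j * x k j = (q) • (x k j * x i j))
    (hanti : ∀ i k j l : Fin 2, i < k → j < l → x i l * x k j = x k j * x i l)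
    (hdiag : ∀ i k j l : Fin 2, i < k → j < l →
      x i j * x k l - x k l * x i j = ((q) - (q⁻¹)) • (x i l * x k j))
    (hgen : Algebra.adjoin ℂ (Set.range fun p : Fin 2 × Fin 2 => x p.1 p.2) = ⊤)
    (hfree : ∀ (B : Type) [Ring B] [Algebra ℂ B] (y : Fin 2 → Fin 2 → B),
      (∀ i j l : Fin 2, j < l → y i j * y i l = (q) • (y i l * y i j)) →
      (∀ i k j : Fin 2, i < k → y i j * y k j = (q) • (y k j * y i j)) →
      (∀ i k j l : Fin 2, i < k → j < l → y i l * y k j = y k j * y i l) →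
      (∀ i k j l : Fin 2, i < k → j < l →
        y i j * y k l - y k l * y i j = ((q) - (q⁻¹)) • (y i l * y k j)) →
      ∃! φ : M →ₐ[ℂ] B, ∀ i j, φ (x i j) = y i j)
    (ι : M →ₐ[ℂ] G) (dInv : G)
    (hd1 : ι (qdet (q) x) * dInv = 1)
    (hd2 : dInv * ι (qdet (q) x) = 1)
    (hgenG : Algebra.adjoin ℂ
      (Set.range (fun p : Fin 2 × Fin 2 => ι (x p.1 p.2)) ∪ {dInv}) = ⊤)
    (hfreeG : ∀ (B : Type) [Ring B] [Algebra ℂ B] (φ : M →ₐ[ℂ] B) (u : B),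
      φ (qdet (q) x) * u = 1 → u * φ (qdet (q) x) = 1 →
      ∃! ψ : G →ₐ[ℂ] B, ψ.comp ι = φ)
    (ΔM : M →ₐ[ℂ] M ⊗[ℂ] M)
    (hΔM : ∀ i j, ΔM (x i j) = ∑ k, x i k ⊗ₜ[ℂ] x k j)
    (ΔG : G →ₐ[ℂ] G ⊗[ℂ] G)
    (hΔG : ∀ m, ΔG (ι m) = Algebra.TensorProduct.map ι ι (ΔM m))
    (εG : G →ₐ[ℂ] ℂ)
    (hεG : ∀ i j, εG (ι (x i j)) = if i = j then 1 else 0)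
    (St : G →ₗ[ℂ] G)
    (hS1 : LinearMap.mul' ℂ G ∘ₗ TensorProduct.map St LinearMap.id ∘ₗ ΔG.toLinearMap
      = Algebra.linearMap ℂ G ∘ₗ εG.toLinearMap)
    (hS2 : LinearMap.mul' ℂ G ∘ₗ TensorProduct.map LinearMap.id St ∘ₗ ΔG.toLinearMap
      = Algebra.linearMap ℂ G ∘ₗ εG.toLinearMap)
    (D : Type) [CommRing D] [Algebra ℂ D]
    (t : Fin 2 → (D)ˣ)
    (πD : G →ₐ[ℂ] D)
    (hπD : ∀ i j, πD (ι (x i j)) = if i = j then (t i : D) else 0)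
    (hfreeD : ∀ (B : Type) [CommRing B] [Algebra ℂ B] (u : Fin 2 → Bˣ),
      ∃! φ : D →ₐ[ℂ] B, ∀ i, φ (t i : D) = (u i : B))
    (ξ1 ξ2 : ℂ) (e : M →ₐ[ℂ] ℂ)
    (he00 : e (x 0 0) = ξ1) (he01 : e (x 0 1) = 0)
    (he10 : e (x 1 0) = 0) (he11 : e (x 1 1) = ξ2)
    (hsep : ∀ k : ℕ, ξ1 - q ^ (2 * k) * ξ2 ≠ 0) :
    Set.range ⇑(coorbit e (adjBeta ΔM ι St)) = dCoinv πD ΔG := by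
  have hdet := qdet_fin_two q x
  let u : Gˣ := ⟨ι (qdet q x), dInv, hd1, hd2⟩
  have hu : (u : G) = ι (x 0 0) * ι (x 1 1) - q • (ι (x 0 1) * ι (x 1 0)) := by
    change ι (qdet q x) = _
    simp [hdet]
  have had : ι (x 0 0) * ι (x 1 1) = u + q • (ι (x 0 1) * ι (x 1 0)) := by
    rw [hu, sub_add_cancel]
  have h : IsQuantumGLTwo q (ι (x 0 0)) (ι (x 0 1)) (ι (x 1 0)) (ι (x 1 1)) u := {
    ne_zero := hq
    ab := by simpa [QCommute] using congrArg ι (hrow 0 0 1 (by decide))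
    ac := by simpa [QCommute] using congrArg ι (hcol 0 1 0 (by decide))
    bd := by simpa [QCommute] using congrArg ι (hcol 0 1 1 (by decide))
    cd := by simpa [QCommute] using congrArg ι (hrow 1 0 1 (by decide))
    bc := by simpa [commute_iff_eq] using congrArg ι (hanti 0 1 0 1 (by decide) (by decide))
    ad := had
    da := by
      have := congrArg ι (hdiag 0 1 0 1 (by decide) (by decide))
      simp only [map_sub, map_mul, map_smul, had, sub_smul] at this
      rw [sub_eq_iff_eq_add'] at this
      rw [← sub_eq_iff_eq_add.2 this]
      abel }
  have hS := antipode_mul_entry hgen hΔM hΔG hεG hS1 hS2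
    (h.sum_mul_antipodeEntry (X := fun i j => ι (x i j)) rfl rfl rfl rfl)
  have hmul := coorbit_mul_entry hΔM hS (e := e) (ξ := ![ξ1, ξ2])
    (fun i j => by fin_cases i <;> fin_cases j <;> simp [he00, he01, he10, he11])
  have hone : coorbit e (adjBeta ΔM ι St) 1 = 1 := by
    have hSt : St 1 = 1 := by
      simpa [Algebra.TensorProduct.one_def] using LinearMap.congr_fun hS1 1
    simp [coorbit, adjBeta, Algebra.TensorProduct.one_def, hSt]
  set Φ := coorbit e (adjBeta ΔM ι St)
  simp only [Fin.sum_univ_two, antipodeEntry, Fin.forall_fin_two, Matrix.cons_val_zero,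
    Matrix.cons_val_one, neg_mul, smul_neg, smul_mul_assoc, smul_smul] at hmul
  have hV : IsQuantumGLTwo.IsCoorbitClosed q (ι (x 0 0)) (ι (x 0 1)) (ι (x 1 0)) (ι (x 1 1)) u ξ1 ξ2
      (LinearMap.range Φ) := by
    constructor
    · exact ⟨1, hone⟩
    · rintro _ ⟨g, rfl⟩
      refine ⟨g * x 0 1, ?_⟩
      rw [(hmul g).1.2]
      simp only [mul_sub, mul_smul_comm, mul_assoc, mul_comm ξ2]
      rw [sub_eq_add_neg]
    · rintro _ ⟨g, rfl⟩
      refine ⟨g * x 1 0, ?_⟩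
      rw [(hmul g).2.1]
      simp only [mul_sub, mul_smul_comm, mul_assoc, mul_comm ξ1]
      abel
    · rintro _ ⟨g, rfl⟩
      refine ⟨g * x 1 1, ?_⟩
      rw [(hmul g).2.2]
      simp only [mul_sub, mul_smul_comm, mul_assoc, mul_comm ξ1]
      abel
  let L : G →ₐ[ℂ] D ⊗[ℂ] G := (Algebra.TensorProduct.map πD (AlgHom.id ℂ G)).comp ΔG
  have hL : IsRowCoaction L (ι (x 0 0)) (ι (x 0 1)) (ι (x 1 0)) (ι (x 1 1)) (t 0) (t 1) := by
    constructor <;> simp [L, hΔG, hΔM, hπD]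
  ext f
  change _ ↔ L f = 1 ⊗ₜ f
  constructor
  · rintro ⟨g, rfl⟩
    let E : Submodule ℂ G :=
      LinearMap.ker (L.toLinearMap - TensorProduct.mk ℂ D G 1)
    have hE (f : G) : f ∈ E ↔ L f = 1 ⊗ₜ f := by
      simp [E, sub_eq_zero]
    have hmem {f y z : G} (hf : f ∈ E) (hyz : L y = (t 0 : D) ⊗ₜ y ∧ L z = (t 1 : D) ⊗ₜ z ∨
        L y = (t 1 : D) ⊗ₜ y ∧ L z = (t 0 : D) ⊗ₜ z) : ↑u⁻¹ * y * f * z ∈ E :=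
      (hE _).2 (hL.map_inv_mul h ((hE f).1 hf) hyz)
    have hstep (f : M) (hf : Φ f ∈ E) (i j : Fin 2) : Φ (f * x i j) ∈ E := by
      obtain ⟨⟨h00, h01⟩, h10, h11⟩ := hmul f
      fin_cases i <;> fin_cases j <;>
        simp only [Fin.zero_eta, Fin.mk_one, h00, h01, h10, h11, ← smul_neg] <;>
        refine add_mem (E.smul_mem _ ?_) (E.smul_mem _ ?_) <;>
        (try refine neg_mem ?_) <;>
        refine hmem hf ?_ <;>
        simp [hL.map_a, hL.map_b, hL.map_c, hL.map_d]
    have hprod (m : M) : ∀ f : M, Φ f ∈ E → Φ (f * m) ∈ E := by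
      have hm : m ∈ Algebra.adjoin ℂ (Set.range fun p : Fin 2 × Fin 2 => x p.1 p.2) :=
        hgen ▸ Algebra.mem_top
      induction hm using Algebra.adjoin_induction with
      | mem y hy =>
        obtain ⟨p, rfl⟩ := hy
        exact fun f hf => hstep f hf p.1 p.2
      | algebraMap r =>
        intro f hf
        rw [← Algebra.commutes, ← Algebra.smul_def, map_smul]
        exact E.smul_mem r hf
      | add y z _ _ hy hz =>
        intro f hf
        rw [mul_add, map_add]
        exact add_mem (hy f hf) (hz f hf)
      | mul y z _ _ hy hz =>
        intro f hf
        rw [← mul_assoc]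
        exact hz _ (hy f hf)
    have := hprod g 1 (by rw [hone, hE]; simp [Algebra.TensorProduct.one_def])
    rw [one_mul] at this
    exact (hE _).1 this
  · intro hf
    obtain ⟨p, hp⟩ := exists_torus_functional t hfreeD
    refine hL.mem_of_coinvariant h hgenG ?_ hp (V := LinearMap.range Φ)
      (h.lowMon_weight_zero_mem hV hsep) (h.highMon_weight_zero_mem hV hsep) hf
    rintro _ (⟨⟨i, j⟩, rfl⟩ | rfl)
    · fin_cases i <;> fin_cases j <;> simp
    · simp [u]
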